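/- arXiv:1103.4968 — 3 statements merged into one kernel-verified Lean document; each statement's English description precedes it below -/
import Mathlib

section
/- There exist a finitely generated group Γ with a finite generating set S, and a sequence (G_n) of finite graphs, such that (G_n) Benjamini–Schramm converges to the Cayley graph Cay(Γ,S), but there is no sequence of S-diagram structures ℓ_n on the graphs G_n (i.e., labellings of the edges of G_n by generators together with orientations) such that the diagrams (G_n, ℓ_n) converge to the Cayley diagram of (Γ,S): that is, for every choice of diagram structures ℓ_n on G_n it fails that for every r the proportion of vertices of G_n whose labelled rooted r-ball is rooted labelled-isomorphic to the labelled rooted r-ball of the Cayley diagram at the identity tends to 1. -/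
open Filter Topology SimpleGraph
open scoped Classical

/-- The Cayley graph of a group with respect to a set `S`:
`x` and `y` are adjacent iff `x⁻¹ * y ∈ S` or `y⁻¹ * x ∈ S` (and `x ≠ y`,
which is automatic when `1 ∉ S`). -/
def cayley {Γ : Type*} [Group Γ] (S : Set Γ) : SimpleGraph Γ :=
  SimpleGraph.fromRel (fun x y => x⁻¹ * y ∈ S)

/-- The set of vertices at graph distance at most `r` from `x`. -/
def ballSet {V : Type*} (G : SimpleGraph V) (x : V) (r : ℕ) : Set V :=
  {y | ∃ w : G.Walk x y, w.length ≤ r}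

lemma self_mem_ballSet {V : Type*} (G : SimpleGraph V) (x : V) (r : ℕ) :
    x ∈ ballSet G x r := ⟨SimpleGraph.Walk.nil, by simp⟩

/-- The rooted `r`-ball of `G` at `x` is rooted-isomorphic to the rooted `r`-ball
of `H` at `y`. -/
def RootedBallIso {V W : Type*} (G : SimpleGraph V) (x : V)
    (H : SimpleGraph W) (y : W) (r : ℕ) : Prop :=
  ∃ f : G.induce (ballSet G x r) ≃g H.induce (ballSet H y r),
    (f ⟨x, self_mem_ballSet G x r⟩).1 = y

/-- The proportion of vertices of a finite graph `G` whose rooted `r`-ball is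
rooted-isomorphic to the rooted `r`-ball of `H` at `y`. -/
noncomputable def ballIsoProportion {V W : Type*} [Fintype V] (G : SimpleGraph V)
    (H : SimpleGraph W) (y : W) (r : ℕ) : ℝ :=
  (Nat.card {x : V // RootedBallIso G x H y r} : ℝ) / (Fintype.card V : ℝ)

/-- Benjamini–Schramm convergence of a sequence of finite graphs to a fixed
(vertex-transitive) graph `H` rooted at `o`: for every `r`, the proportion of
vertices whose rooted `r`-ball is rooted-isomorphic to the `r`-ball of `H` at `o`
tends to `1`. -/
def BSLimit {V : ℕ → Type*} [∀ n, Fintype (V n)] (G : ∀ n, SimpleGraph (V n))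
    {W : Type*} (H : SimpleGraph W) (o : W) : Prop :=
  ∀ r : ℕ, Tendsto (fun n => ballIsoProportion (G n) H o r) atTop (𝓝 1)

/-- An `S`-diagram structure on a graph `G`: each edge carries a label from `S`
together with an orientation (`label x y = some s` means the edge `{x, y}` carries
label `s` oriented from `x` to `y`); if the inverse of the label also lies in `S`,
the reverse direction carries the inverse label; in particular edges labelled by an
involutive generator are unoriented (labelled the same in both directions). -/
structure DiagramStruct {V : Type*} {Γ : Type*} [Group Γ] (G : SimpleGraph V)
    (S : Set Γ) where
  label : V → V → Option Γ
  label_mem : ∀ x y s, label x y = some s → s ∈ S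
  label_inv : ∀ x y s, label x y = some s → s⁻¹ ∈ S → label y x = some s⁻¹
  adj_iff : ∀ x y, G.Adj x y ↔ ((label x y).isSome ∨ (label y x).isSome)

/-- The labelling of the Cayley diagram of `(Γ, S)`: for each `s ∈ S`, the edge
`{x, x * s}` is labelled `s` and oriented from `x` to `x * s`. -/
noncomputable def cayleyLabel {Γ : Type*} [Group Γ] (S : Set Γ) : Γ → Γ → Option Γ :=
  fun x y => if x⁻¹ * y ∈ S then some (x⁻¹ * y) else none

/-- There is a rooted labelled-isomorphism from the labelled rooted `r`-ball of
`(G, ℓ)` at `x` to the labelled rooted `r`-ball of `(H, m)` at `y`: a rooted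
isomorphism of the underlying rooted balls preserving labels and orientations. -/
def LabelledBallIso {V W Γ : Type*} (G : SimpleGraph V) (ℓ : V → V → Option Γ) (x : V)
    (H : SimpleGraph W) (m : W → W → Option Γ) (y : W) (r : ℕ) : Prop :=
  ∃ f : G.induce (ballSet G x r) ≃g H.induce (ballSet H y r),
    (f ⟨x, self_mem_ballSet G x r⟩).1 = y ∧
    ∀ u v : ballSet G x r, ℓ u.1 v.1 = m (f u).1 (f v).1

/-- For every finite set of elements of a free group there is a homomorphism to a finite
group which is injective on that set. -/
lemma exists_finite_quotient_injOn {α : Type} (B : Set (FreeGroup α))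
    (hB : B.Finite) :
    ∃ (P : Type) (_ : Group P) (_ : Fintype P) (φ : FreeGroup α →* P), Set.InjOn φ B := by
  let C : Set (FreeGroup α) :=
    insert 1 (⋃ w ∈ B, FreeGroup.mk '' {L | L ∈ w.toWord.tails})
  have hC : C.Finite := by
    refine Set.Finite.insert _ (hB.biUnion fun w _ => Set.Finite.image _ ?_)
    exact List.finite_toSet _
  have : Finite C := hC
  have : Fintype C := Fintype.ofFinite C
  have hσ : ∀ i : α, ∃ σ : Equiv.Perm C,
      ∀ c : C, ∀ h : FreeGroup.of i * c.1 ∈ C, σ c = ⟨FreeGroup.of i * c.1, h⟩ := by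
    intro i
    obtain ⟨σ, h⟩ := Equiv.Perm.exists_extending_pair
      (fun c : {c : C // FreeGroup.of i * c.1 ∈ C} => c.1)
      (fun c : {c : C // FreeGroup.of i * c.1 ∈ C} => (⟨FreeGroup.of i * c.1.1, c.2⟩ : C))
      Subtype.val_injective
      (fun c d hcd => Subtype.ext (Subtype.ext (mul_left_cancel (congrArg Subtype.val hcd))))
    exact ⟨σ, fun c hc => h ⟨c, hc⟩⟩
  choose σ hσ using hσ
  let φ : FreeGroup α →* Equiv.Perm C := FreeGroup.lift σ
  have key : ∀ L : List (α × Bool), (∀ L', L' <:+ L → FreeGroup.mk L' ∈ C) →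
      ((φ (FreeGroup.mk L) ⟨1, Set.mem_insert _ _⟩ : C) : FreeGroup α) = FreeGroup.mk L := by
    intro L
    induction L with
    | nil => intro _; simp [FreeGroup.one_eq_mk.symm]
    | cons p L ih =>
      intro h
      have ih' := ih fun L' hL' => h L' (hL'.trans (List.suffix_cons _ _))
      have h1 := h _ (List.suffix_refl _)
      have h2 := h _ (List.suffix_cons p L)
      obtain ⟨i, b⟩ := p
      have hsplit : FreeGroup.mk ((i, b) :: L) = FreeGroup.mk [(i, b)] * FreeGroup.mk L := by
        simp [FreeGroup.mul_mk]
      have ih'' : φ (FreeGroup.mk L) ⟨1, Set.mem_insert _ _⟩ = ⟨FreeGroup.mk L, h2⟩ :=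
        Subtype.ext ih'
      rw [hsplit] at h1 ⊢
      rw [map_mul, Equiv.Perm.mul_apply, ih'']
      cases b with
      | true =>
        have : φ (FreeGroup.mk [(i, true)]) = σ i := by simp [φ]
        rw [this, hσ i _ h1]
        rfl
      | false =>
        have e : FreeGroup.mk [(i, false)] = (FreeGroup.of i)⁻¹ := by
          simp [FreeGroup.of, FreeGroup.inv_mk, FreeGroup.invRev]
        have hφ : φ (FreeGroup.of i)⁻¹ = (σ i)⁻¹ := by simp [φ]
        rw [e] at h1 ⊢
        have h3 : FreeGroup.of i * (⟨_, h1⟩ : C).1 ∈ C := by simpa using h2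
        have : σ i ⟨_, h1⟩ = ⟨FreeGroup.mk L, h2⟩ := by
          rw [hσ i _ h3]; ext; simp
        rw [hφ, ← this]
        simp
  have key' : ∀ w ∈ B, ((φ w ⟨1, Set.mem_insert _ _⟩ : C) : FreeGroup α) = w := by
    intro w hw
    have := key w.toWord fun L' hL' => Set.mem_insert_of_mem _
      (Set.mem_biUnion hw ⟨L', (List.mem_tails _ _).2 hL', rfl⟩)
    rwa [FreeGroup.mk_toWord] at this
  refine ⟨Equiv.Perm C, inferInstance, inferInstance, φ, fun u hu v hv huv => ?_⟩
  rw [← key' u hu, ← key' v hv, huv]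

/-- Every finite digraph of out-degree two carries a system of signs on its edges which is far
from being a coboundary. -/
lemma exists_signs_far_from_coboundary {P U : Type} [Fintype P] [Nonempty P] [Group U] [Fintype U]
    (hU : Fintype.card U = 2) (p : P → Fin 2 → P) :
    ∃ τ : P → Fin 2 → U, ∀ g : P → U,
      Fintype.card P <
        10 * (Finset.univ.filter fun e : P × Fin 2 => g (p e.1 e.2) ≠ τ e.1 e.2 * g e.1).card := by
  by_contra! hcon
  choose g hg using hcon
  let E : (P → Fin 2 → U) → Finset (P × Fin 2) := fun τ =>
    Finset.univ.filter fun e : P × Fin 2 => g τ (p e.1 e.2) ≠ τ e.1 e.2 * g τ e.1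
  have huniq : ∀ a b c : U, a ≠ c → b ≠ c → a = b := by
    intro a b c hac hbc
    by_contra hab
    have : ({a, b, c} : Finset U).card ≤ Fintype.card U := Finset.card_le_univ _
    rw [Finset.card_eq_three.2 ⟨a, b, c, hab, hac, hbc, rfl⟩, hU] at this
    omega
  have hinj : Function.Injective fun τ => (g τ, E τ) := by
    intro τ τ' h
    simp only [Prod.mk.injEq] at h
    obtain ⟨h1, h2⟩ := h
    funext x s
    have h3 : ((x, s) ∈ E τ ↔ (x, s) ∈ E τ') := by rw [h2]
    simp only [E, Finset.mem_filter, Finset.mem_univ, true_and, h1] at h3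
    by_cases h4 : g τ' (p x s) = τ x s * g τ' x
    · have h5 : g τ' (p x s) = τ' x s * g τ' x := by
        by_contra h5; exact (h3.2 h5) h4
      exact mul_right_cancel (h4.symm.trans h5)
    · have h5 := h3.1 h4
      exact mul_right_cancel (huniq _ _ _ (Ne.symm h4) (Ne.symm h5))
  let N := Fintype.card P
  let F : Finset (Finset (P × Fin 2)) := Finset.univ.filter fun e => 10 * e.card ≤ N
  have hcard : Fintype.card (P → Fin 2 → U) ≤ Fintype.card (P → U) * F.card := by
    rw [← Finset.card_univ, ← Finset.card_univ, ← Finset.card_product]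
    refine Finset.card_le_card_of_injOn (fun τ => (g τ, E τ)) (fun τ _ => ?_) hinj.injOn
    simpa [F] using hg τ
  have hF : (F.card : ℝ) ≤ ((1 + (2 / 3) ^ 10) ^ 2 * (3 / 2)) ^ N := by
    have h1 := Fintype.sum_pow_mul_eq_add_pow (P × Fin 2) ((2 / 3 : ℝ) ^ 10) 1
    have h2 : Fintype.card (P × Fin 2) = 2 * N := by simp [N, mul_comm]
    rw [h2] at h1
    have h3 : (F.card : ℝ) ≤
        ∑ e : Finset (P × Fin 2), (3 / 2 : ℝ) ^ N * ((2 / 3 : ℝ) ^ 10) ^ e.card := by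
      rw [Finset.card_eq_sum_ones, Nat.cast_sum]
      refine (Finset.sum_le_sum fun e he => ?_).trans
        (Finset.sum_le_sum_of_subset_of_nonneg (Finset.subset_univ F) fun _ _ _ => by positivity)
      have he' : 10 * e.card ≤ N := by simpa [F] using he
      calc ((1 : ℕ) : ℝ) = (3 / 2 : ℝ) ^ (10 * e.card) * (2 / 3 : ℝ) ^ (10 * e.card) := by
            rw [← mul_pow]; norm_num
        _ ≤ (3 / 2 : ℝ) ^ N * (2 / 3 : ℝ) ^ (10 * e.card) := by
            gcongr
            norm_num
        _ = _ := by rw [pow_mul (2 / 3 : ℝ)]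
    rw [← Finset.mul_sum] at h3
    simp only [one_pow, mul_one] at h1
    rw [h1] at h3
    rw [mul_pow, ← pow_mul, add_comm 1, mul_comm (_ ^ (2 * N))]
    exact h3
  have hN : N ≠ 0 := Fintype.card_ne_zero
  have hlt : ((1 + (2 / 3 : ℝ) ^ 10) ^ 2 * (3 / 2)) ^ N < 2 ^ N :=
    pow_lt_pow_left₀ (by norm_num) (by positivity) hN
  have hcard' : ((2 : ℝ) ^ N) * 2 ^ N ≤ 2 ^ N * F.card := by
    have : 2 ^ N * 2 ^ N ≤ 2 ^ N * F.card := by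
      simpa [hU, N, pow_mul, ← mul_pow] using hcard
    exact_mod_cast this
  have := le_of_mul_le_mul_left hcard' (by positivity)
  linarith

lemma mem_ballSet_of_adj {V : Type*} {G : SimpleGraph V} {x u v : V} {r : ℕ}
    (hu : u ∈ ballSet G x r) (h : G.Adj u v) : v ∈ ballSet G x (r + 1) := by
  obtain ⟨w, hw⟩ := hu
  exact ⟨w.concat h, by simpa using hw⟩

lemma ballSet_mono {V : Type*} (G : SimpleGraph V) (x : V) {r s : ℕ} (h : r ≤ s) :
    ballSet G x r ⊆ ballSet G x s :=
  fun _ ⟨w, hw⟩ => ⟨w, hw.trans h⟩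

lemma finite_ballSet {V : Type*} (G : SimpleGraph V)
    (hG : ∀ x, {y | G.Adj x y}.Finite) (x : V) (r : ℕ) : (ballSet G x r).Finite := by
  induction r generalizing x with
  | zero =>
    refine (Set.finite_singleton x).subset ?_
    rintro y ⟨w, hw⟩
    exact (w.eq_of_length_eq_zero (Nat.le_zero.1 hw)).symm
  | succ r ih =>
    refine (((hG x).biUnion fun y _ => ih y).insert x).subset ?_
    rintro y ⟨w, hw⟩
    cases w with
    | nil => exact Set.mem_insert _ _
    | cons h w =>
      exact Set.mem_insert_of_mem _ (Set.mem_biUnion h ⟨w, by simpa using hw⟩)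

/-- A graph covering which is injective on the `(r + 1)`-ball restricts to a rooted isomorphism
between `r`-balls. -/
lemma rootedBallIso_of_covering {V W : Type*} {G : SimpleGraph V} {H : SimpleGraph W}
    (Φ : W → V) (o : W) (r : ℕ) (hadj : ∀ u v, H.Adj u v → G.Adj (Φ u) (Φ v))
    (hlift : ∀ u v', G.Adj (Φ u) v' → ∃ v, H.Adj u v ∧ Φ v = v')
    (hinj : Set.InjOn Φ (ballSet H o (r + 1))) : RootedBallIso G (Φ o) H o r := by
  have hsub : ballSet H o r ⊆ ballSet H o (r + 1) := ballSet_mono _ _ (Nat.le_succ r)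
  have hmap : ∀ u ∈ ballSet H o r, Φ u ∈ ballSet G (Φ o) r := by
    rintro u ⟨w, hw⟩
    exact ⟨w.map (⟨Φ, fun h => hadj _ _ h⟩ : H →g G), by simpa using hw⟩
  have hwalk : ∀ (p q : V) (w : G.Walk p q) (u : W), Φ u = p →
      ∃ v, Φ v = q ∧ ∃ w' : H.Walk u v, w'.length = w.length := by
    intro p q w
    induction w with
    | nil => exact fun u hu => ⟨u, hu, Walk.nil, rfl⟩
    | cons h w ih =>
      rintro u rfl
      obtain ⟨v, huv, hv⟩ := hlift _ _ h
      obtain ⟨v', hv', w', hw'⟩ := ih v hv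
      exact ⟨v', hv', Walk.cons huv w', by simp [hw']⟩
  let e : ballSet H o r → ballSet G (Φ o) r := fun u => ⟨Φ u.1, hmap _ u.2⟩
  have he : Function.Bijective e := by
    constructor
    · intro u v h
      exact Subtype.ext (hinj (hsub u.2) (hsub v.2) (congrArg Subtype.val h))
    · rintro ⟨q, w, hw⟩
      obtain ⟨v, hv, w', hw'⟩ := hwalk _ _ w o rfl
      exact ⟨⟨v, w', hw'.trans_le hw⟩, Subtype.ext hv⟩
  let E : H.induce (ballSet H o r) ≃g G.induce (ballSet G (Φ o) r) :=
    { toEquiv := Equiv.ofBijective e he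
      map_rel_iff' := by
        intro u v
        change G.Adj (Φ u.1) (Φ v.1) ↔ H.Adj u.1 v.1
        refine ⟨fun h => ?_, hadj _ _⟩
        obtain ⟨v₁, hv₁, hv⟩ := hlift _ _ h
        rwa [← hinj (mem_ballSet_of_adj u.2 hv₁) (hsub v.2) hv] }
  refine ⟨E.symm, ?_⟩
  have : E.symm ⟨Φ o, self_mem_ballSet _ _ _⟩ = ⟨o, self_mem_ballSet _ _ _⟩ := by
    rw [RelIso.symm_apply_eq]
    rfl
  rw [this]

/-- The group of the example: the product of a free group of rank two and `ℤ/3`. -/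
abbrev FreeProdThree : Type := FreeGroup (Fin 2) × Multiplicative (ZMod 3)

/-- The standard generator of the factor `ℤ/3`. -/
def fiberGen : FreeProdThree := (1, Multiplicative.ofAdd 1)

/-- The standard generators of the free factor. -/
def baseGen (i : Fin 2) : FreeProdThree := (FreeGroup.of i, 1)

/-- The standard generating set of `FreeProdThree`. -/
def stdGens : Set FreeProdThree := insert fiberGen (Set.range baseGen)

lemma finite_stdGens : stdGens.Finite := (Set.finite_range _).insert _

lemma one_notMem_stdGens : (1 : FreeProdThree) ∉ stdGens := by
  rintro (h | ⟨i, h⟩)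
  · exact absurd (congrArg Prod.snd h) (by decide)
  · exact FreeGroup.of_ne_one i (congrArg Prod.fst h)

lemma closure_stdGens : Subgroup.closure stdGens = ⊤ := by
  rw [eq_top_iff]
  rintro ⟨w, m⟩ -
  have h1 : ∀ w : FreeGroup (Fin 2), ((w, 1) : FreeProdThree) ∈ Subgroup.closure stdGens := by
    intro w
    induction w using FreeGroup.induction_on with
    | C1 => exact one_mem _
    | of i => exact Subgroup.subset_closure (Or.inr ⟨i, rfl⟩)
    | inv_of i h => simpa using inv_mem h
    | mul u v hu hv => simpa using mul_mem hu hv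
  have h2 : fiberGen ^ (Multiplicative.toAdd m).val ∈ Subgroup.closure stdGens :=
    Subgroup.pow_mem _ (Subgroup.subset_closure (Set.mem_insert _ _)) _
  have h3 : ((w, m) : FreeProdThree) = (w, 1) * fiberGen ^ (Multiplicative.toAdd m).val := by
    ext1
    · simp [fiberGen]
    · change m = 1 * (Multiplicative.ofAdd (1 : ZMod 3)) ^ (Multiplicative.toAdd m).val
      rw [← ofAdd_nsmul]
      simp
  rw [h3]
  exact mul_mem (h1 w) h2

lemma cayley_adj_iff {u v : FreeProdThree} :
    (cayley stdGens).Adj u v ↔ u⁻¹ * v ∈ stdGens ∨ v⁻¹ * u ∈ stdGens := by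
  simp only [cayley, SimpleGraph.fromRel_adj, and_iff_right_iff_imp]
  rintro h rfl
  simp [one_notMem_stdGens] at h

lemma finite_cayley_neighbors (u : FreeProdThree) : {v | (cayley stdGens).Adj u v}.Finite := by
  have h : {v | (cayley stdGens).Adj u v} ⊆
      (fun s => u * s) '' stdGens ∪ (fun s => u * s⁻¹) '' stdGens := by
    intro v hv
    rcases cayley_adj_iff.1 hv with h | h
    · exact Or.inl ⟨_, h, by simp⟩
    · exact Or.inr ⟨_, h, by simp⟩
  exact ((finite_stdGens.image _).union (finite_stdGens.image _)).subset h

section SignedLift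

variable {P : Type} [Group P] (φ : FreeGroup (Fin 2) →* P) (τ : P → Fin 2 → (ZMod 3)ˣ)

/-- The permutation of `P × ℤ/3` covering right multiplication by `φ s` and acting on the fibre
over `x` by the sign `τ x s`. -/
def liftPerm (s : Fin 2) : Equiv.Perm (P × ZMod 3) where
  toFun y := (y.1 * φ (FreeGroup.of s), τ y.1 s * y.2)
  invFun y := (y.1 * (φ (FreeGroup.of s))⁻¹,
    ((τ (y.1 * (φ (FreeGroup.of s))⁻¹) s)⁻¹ : (ZMod 3)ˣ) * y.2)
  left_inv y := by simp only [mul_inv_cancel_right, Units.inv_mul_cancel_left]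
  right_inv y := by simp only [inv_mul_cancel_right, Units.mul_inv_cancel_left]

lemma liftPerm_apply (s : Fin 2) (y : P × ZMod 3) :
    liftPerm φ τ s y = (y.1 * φ (FreeGroup.of s), τ y.1 s * y.2) := rfl

/-- The graph on `P × ℤ/3` whose fibres over `P` are triangles, fibres over `x` and `x * φ s`
being matched through the sign `τ x s`. -/
def liftGraph : SimpleGraph (P × ZMod 3) :=
  SimpleGraph.fromRel fun y y' => y.1 = y'.1 ∨ ∃ s, y' = liftPerm φ τ s y

/-- The action of the free group on `P × ℤ/3` whose generators act by the inverses
of `liftPerm`. -/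
def liftAction : FreeGroup (Fin 2) →* Equiv.Perm (P × ZMod 3) :=
  FreeGroup.lift fun s => (liftPerm φ τ s)⁻¹

lemma liftAction_of (s : Fin 2) : liftAction φ τ (FreeGroup.of s) = (liftPerm φ τ s)⁻¹ := by
  simp [liftAction]

lemma liftAction_fst (w : FreeGroup (Fin 2)) (y : P × ZMod 3) :
    (liftAction φ τ w y).1 = y.1 * (φ w)⁻¹ := by
  induction w using FreeGroup.induction_on generalizing y with
  | C1 => simp
  | of i => rw [liftAction_of]; rfl
  | inv_of i h => rw [_root_.map_inv, liftAction_of, inv_inv, _root_.map_inv, inv_inv]; rfl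
  | mul u v hu hv => simp [hu, hv, mul_assoc]

/-- The map from the Cayley graph to the lift which unrolls it from the vertex `y`. -/
def unroll (y : P × ZMod 3) (u : FreeProdThree) : P × ZMod 3 :=
  (liftAction φ τ u.1)⁻¹ (y.1, y.2 + Multiplicative.toAdd u.2)

lemma unroll_one (y : P × ZMod 3) : unroll φ τ y 1 = y := by
  simp [unroll]

lemma unroll_fst (y : P × ZMod 3) (u : FreeProdThree) : (unroll φ τ y u).1 = y.1 * φ u.1 := by
  rw [unroll, ← _root_.map_inv, liftAction_fst]
  simp

lemma unroll_mul_baseGen (y : P × ZMod 3) (u : FreeProdThree) (s : Fin 2) :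
    unroll φ τ y (u * baseGen s) = liftPerm φ τ s (unroll φ τ y u) := by
  simp [unroll, baseGen, liftAction_of]

lemma unroll_injective_snd (y : P × ZMod 3) {u v : FreeProdThree} (h : u.1 = v.1)
    (huv : unroll φ τ y u = unroll φ τ y v) : u = v := by
  unfold unroll at huv
  rw [h] at huv
  have := (Prod.ext_iff.1 ((liftAction φ τ v.1)⁻¹.injective huv)).2
  exact Prod.ext h (by simpa using this)

lemma fst_eq_or_of_liftGraph_adj {y y' : P × ZMod 3} (h : (liftGraph φ τ).Adj y y') :
    y.1 = y'.1 ∨ (∃ s, y' = liftPerm φ τ s y) ∨ ∃ s, y = liftPerm φ τ s y' := by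
  rcases h with ⟨-, (h | h) | (h | h)⟩
  exacts [Or.inl h, Or.inr (Or.inl h), Or.inl h.symm, Or.inr (Or.inr h)]

variable {φ}

lemma liftGraph_adj_liftPerm (hφ : ∀ s, φ (FreeGroup.of s) ≠ 1) (y : P × ZMod 3) (s : Fin 2) :
    (liftGraph φ τ).Adj y (liftPerm φ τ s y) := by
  refine ⟨fun h => hφ s ?_, Or.inl (Or.inr ⟨s, rfl⟩)⟩
  have := (Prod.ext_iff.1 h).1
  exact left_eq_mul.1 this

lemma ofAdd_eq_one_or (m : Multiplicative (ZMod 3)) :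
    m = 1 ∨ m = Multiplicative.ofAdd 1 ∨ m = (Multiplicative.ofAdd 1)⁻¹ := by
  revert m; decide

lemma liftGraph_adj_unroll (hφ : ∀ s, φ (FreeGroup.of s) ≠ 1) (y : P × ZMod 3)
    {u v : FreeProdThree} (h : (cayley stdGens).Adj u v) :
    (liftGraph φ τ).Adj (unroll φ τ y u) (unroll φ τ y v) := by
  have key : ∀ u v : FreeProdThree, u⁻¹ * v ∈ stdGens →
      (liftGraph φ τ).Adj (unroll φ τ y u) (unroll φ τ y v) := by
    rintro u v (h | ⟨s, h⟩)
    · obtain rfl : v = u * fiberGen := by rw [← h]; simp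
      refine ⟨fun h' => ?_, Or.inl (Or.inl ?_)⟩
      · have := unroll_injective_snd φ τ y (by simp [fiberGen]) h'
        exact one_notMem_stdGens (left_eq_mul.1 this ▸ Or.inl rfl)
      · simp [unroll_fst, fiberGen]
    · obtain rfl : v = u * baseGen s := by rw [h]; simp
      rw [unroll_mul_baseGen]
      exact liftGraph_adj_liftPerm τ hφ _ s
  rcases cayley_adj_iff.1 h with h | h
  · exact key u v h
  · exact (key v u h).symm

lemma exists_adj_unroll_eq (y : P × ZMod 3) (u : FreeProdThree) (y' : P × ZMod 3)
    (h : (liftGraph φ τ).Adj (unroll φ τ y u) y') :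
    ∃ v, (cayley stdGens).Adj u v ∧ unroll φ τ y v = y' := by
  rcases fst_eq_or_of_liftGraph_adj φ τ h with h1 | ⟨s, h1⟩ | ⟨s, h1⟩
  · let v : FreeProdThree := (u.1, Multiplicative.ofAdd ((liftAction φ τ u.1 y').2 - y.2))
    have hv : unroll φ τ y v = y' := by
      rw [unroll, Equiv.Perm.inv_eq_iff_eq]
      ext1
      · rw [liftAction_fst, ← h1, unroll_fst]
        exact (mul_inv_cancel_right _ _).symm
      · simp [v]
    refine ⟨v, ?_, hv⟩
    rw [cayley_adj_iff]
    have hne : u ≠ v := fun huv => h.ne (by rw [← hv, ← huv])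
    have hfst : (u⁻¹ * v).1 = 1 := by simp [v]
    rcases ofAdd_eq_one_or (u⁻¹ * v).2 with h2 | h2 | h2
    · exact absurd (inv_mul_eq_one.1 (Prod.ext hfst h2)) hne
    · exact Or.inl (Or.inl (Prod.ext hfst h2))
    · refine Or.inr (Or.inl ?_)
      have h3 : u⁻¹ * v = fiberGen⁻¹ := Prod.ext (by rw [hfst]; simp [fiberGen]) h2
      rw [← inv_inj, ← h3]
      group
  · refine ⟨u * baseGen s, cayley_adj_iff.2 (Or.inl (Or.inr ⟨s, by simp⟩)), ?_⟩
    rw [unroll_mul_baseGen, h1]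
  · refine ⟨u * (baseGen s)⁻¹, cayley_adj_iff.2 (Or.inr (Or.inr ⟨s, by simp⟩)), ?_⟩
    apply (liftPerm φ τ s).injective
    rw [← unroll_mul_baseGen, ← h1]
    simp

lemma rootedBallIso_liftGraph (hφ : ∀ s, φ (FreeGroup.of s) ≠ 1) (r : ℕ)
    (hinj : Set.InjOn φ (Prod.fst '' ballSet (cayley stdGens) 1 (r + 1))) (y : P × ZMod 3) :
    RootedBallIso (liftGraph φ τ) y (cayley stdGens) 1 r := by
  have := rootedBallIso_of_covering (G := liftGraph φ τ) (H := cayley stdGens)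
    (unroll φ τ y) 1 r (fun u v h => liftGraph_adj_unroll τ hφ y h)
    (fun u v' h => exists_adj_unroll_eq τ y u v' h) ?_
  · rwa [unroll_one] at this
  · intro u hu v hv h
    refine unroll_injective_snd φ τ y (hinj ⟨u, hu, rfl⟩ ⟨v, hv, rfl⟩ ?_) h
    have := congrArg Prod.fst h
    rw [unroll_fst, unroll_fst] at this
    exact mul_left_cancel this

end SignedLift

/-- A labelled isomorphism of balls, presented as a parametrization of the ball of `G` by the ball
of `H`. -/
lemma LabelledBallIso.exists_param {V W Γ : Type*} {G : SimpleGraph V} {ℓ : V → V → Option Γ}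
    {x : V} {H : SimpleGraph W} {m : W → W → Option Γ} {o : W} {r : ℕ}
    (h : LabelledBallIso G ℓ x H m o r) :
    ∃ e : W → V, e o = x ∧ (∀ u ∈ ballSet H o r, ∀ v ∈ ballSet H o r,
      (G.Adj (e u) (e v) ↔ H.Adj u v) ∧ ℓ (e u) (e v) = m u v) ∧
      ∀ y ∈ ballSet G x r, ∃ u ∈ ballSet H o r, e u = y := by
  obtain ⟨f, hf, hl⟩ := h
  have he : ∀ u (hu : u ∈ ballSet H o r),
      (fun u => if hu : u ∈ ballSet H o r then (f.symm ⟨u, hu⟩).1 else x) u =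
        (f.symm ⟨u, hu⟩).1 := fun u hu => dif_pos hu
  refine ⟨fun u => if hu : u ∈ ballSet H o r then (f.symm ⟨u, hu⟩).1 else x, ?_, ?_, ?_⟩
  · rw [he o (self_mem_ballSet _ _ _)]
    have : f.symm ⟨o, self_mem_ballSet _ _ _⟩ = ⟨x, self_mem_ballSet _ _ _⟩ := by
      rw [RelIso.symm_apply_eq]
      exact Subtype.ext hf.symm
    rw [this]
  · intro u hu v hv
    rw [he u hu, he v hv]
    refine ⟨f.symm.map_rel_iff (a := ⟨u, hu⟩) (b := ⟨v, hv⟩), ?_⟩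
    rw [hl]
    simp
  · intro y hy
    refine ⟨(f ⟨y, hy⟩).1, (f ⟨y, hy⟩).2, ?_⟩
    rw [he _ (f ⟨y, hy⟩).2]
    simp

lemma adj_mul_fiberGen (u : FreeProdThree) : (cayley stdGens).Adj u (u * fiberGen) :=
  cayley_adj_iff.2 (Or.inl (Or.inl (by simp)))

lemma cayleyLabel_mul_fiberGen (u : FreeProdThree) :
    cayleyLabel stdGens u (u * fiberGen) = some fiberGen := by
  have : u⁻¹ * (u * fiberGen) = fiberGen := by simp
  rw [cayleyLabel, this]
  exact if_pos (Set.mem_insert _ _)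

lemma eq_mul_of_cayleyLabel_eq {u v s : FreeProdThree}
    (h : cayleyLabel stdGens u v = some s) : v = u * s := by
  unfold cayleyLabel at h
  split_ifs at h
  rw [← Option.some_injective _ h]
  simp

lemma mul_fiberGen_comm (u : FreeProdThree) : u * fiberGen = fiberGen * u :=
  Prod.ext (by simp [fiberGen]) (mul_comm _ _)

section Rigidity

variable {P : Type} [Group P] {φ : FreeGroup (Fin 2) →* P} {τ : P → Fin 2 → (ZMod 3)ˣ}

lemma eq_of_adj_of_fst_eq
    (hφ : ∀ i j, φ (FreeGroup.of i) = φ (FreeGroup.of j) → i = j)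
    (hφ' : ∀ i j, φ (FreeGroup.of i) * φ (FreeGroup.of j) ≠ 1)
    {v p q : P × ZMod 3} (hp : (liftGraph φ τ).Adj v p) (hq : (liftGraph φ τ).Adj v q)
    (hpq : p.1 = q.1) (hvp : v.1 ≠ p.1) : p = q := by
  rcases fst_eq_or_of_liftGraph_adj φ τ hp with h | ⟨s, hs⟩ | ⟨s, hs⟩
  · exact absurd h hvp
  · rcases fst_eq_or_of_liftGraph_adj φ τ hq with h | ⟨t, ht⟩ | ⟨t, ht⟩
    · exact absurd (h.trans hpq.symm) hvp
    · rw [hs, ht] at hpq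
      rw [hs, ht, hφ s t (mul_left_cancel hpq)]
    · have h1 : p.1 = v.1 * φ (FreeGroup.of s) := congrArg Prod.fst hs
      have h2 : v.1 = q.1 * φ (FreeGroup.of t) := congrArg Prod.fst ht
      rw [h2, ← hpq, mul_assoc] at h1
      exact absurd (left_eq_mul.1 h1) (hφ' t s)
  · rcases fst_eq_or_of_liftGraph_adj φ τ hq with h | ⟨t, ht⟩ | ⟨t, ht⟩
    · exact absurd (h.trans hpq.symm) hvp
    · have h1 : q.1 = v.1 * φ (FreeGroup.of t) := congrArg Prod.fst ht
      have h2 : v.1 = p.1 * φ (FreeGroup.of s) := congrArg Prod.fst hs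
      rw [h2, hpq, mul_assoc] at h1
      exact absurd (left_eq_mul.1 h1) (hφ' s t)
    · have h1 : v.1 = q.1 * φ (FreeGroup.of t) := congrArg Prod.fst ht
      have h2 : v.1 = p.1 * φ (FreeGroup.of s) := congrArg Prod.fst hs
      rw [h2, hpq] at h1
      obtain rfl := hφ s t (mul_left_cancel h1)
      exact (liftPerm φ τ s).injective (hs.symm.trans ht)

lemma neg_eq_of_adj {χ : P →* ℤˣ} (hχ : ∀ i, χ (φ (FreeGroup.of i)) = -1)
    {v p : P × ZMod 3} (h : (liftGraph φ τ).Adj v p) (hvp : v.1 ≠ p.1) : χ p.1 = -χ v.1 := by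
  rcases fst_eq_or_of_liftGraph_adj φ τ h with h | ⟨s, rfl⟩ | ⟨s, rfl⟩
  · exact absurd h hvp
  · simp [liftPerm_apply, hχ]
  · simp [liftPerm_apply, hχ]

/-- All triangles of the lift are fibres. -/
lemma fst_eq_of_triangle
    (hφ : ∀ i j, φ (FreeGroup.of i) = φ (FreeGroup.of j) → i = j)
    (hφ' : ∀ i j, φ (FreeGroup.of i) * φ (FreeGroup.of j) ≠ 1)
    {χ : P →* ℤˣ} (hχ : ∀ i, χ (φ (FreeGroup.of i)) = -1)
    {y v w : P × ZMod 3} (hyv : (liftGraph φ τ).Adj y v) (hvw : (liftGraph φ τ).Adj v w)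
    (hyw : (liftGraph φ τ).Adj y w) : y.1 = v.1 := by
  by_contra h
  by_cases h1 : w.1 = y.1
  · exact hyw.ne (eq_of_adj_of_fst_eq hφ hφ' hyv.symm hvw h1.symm (Ne.symm h))
  · by_cases h2 : v.1 = w.1
    · exact hvw.ne (eq_of_adj_of_fst_eq hφ hφ' hyv hyw h2 h)
    · have h3 := neg_eq_of_adj hχ hyv h
      have h4 := neg_eq_of_adj hχ hyw (Ne.symm h1)
      have h5 := neg_eq_of_adj hχ hvw h2
      rw [h4, h3, neg_neg] at h5
      exact units_ne_neg_self _ h5.symm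

/-- A vertex with the correct labelled ball has a unique outgoing edge labelled by the generator
of `ℤ/3`, and this edge lies in the fibre. -/
lemma exists_fiber_direction
    (hφ : ∀ i j, φ (FreeGroup.of i) = φ (FreeGroup.of j) → i = j)
    (hφ' : ∀ i j, φ (FreeGroup.of i) * φ (FreeGroup.of j) ≠ 1)
    {χ : P →* ℤˣ} (hχ : ∀ i, χ (φ (FreeGroup.of i)) = -1)
    (ℓ : DiagramStruct (liftGraph φ τ) stdGens) {y : P × ZMod 3}
    (hy : LabelledBallIso (liftGraph φ τ) ℓ.label y (cayley stdGens) (cayleyLabel stdGens) 1 2) :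
    ∃ j : (ZMod 3)ˣ, ∀ v, ℓ.label y v = some fiberGen ↔ v = (y.1, y.2 + j) := by
  obtain ⟨e, he1, he, hsurj⟩ := hy.exists_param
  have m1 := self_mem_ballSet (cayley stdGens) 1 2
  have a1 : (cayley stdGens).Adj 1 fiberGen := by simpa using adj_mul_fiberGen 1
  have a2 := adj_mul_fiberGen fiberGen
  have a3 : (cayley stdGens).Adj 1 (fiberGen * fiberGen) :=
    cayley_adj_iff.2 (Or.inr (Or.inl (by simp only [fiberGen]; decide)))
  have mem_of_adj : ∀ u, (cayley stdGens).Adj 1 u → u ∈ ballSet (cayley stdGens) 1 2 :=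
    fun u hu => mem_ballSet_of_adj (self_mem_ballSet _ 1 1) hu
  have mz := mem_of_adj _ a1
  have mzz := mem_of_adj _ a3
  have b1 := (he _ m1 _ mz).1.2 a1
  have b2 := (he _ mz _ mzz).1.2 a2
  have b3 := (he _ m1 _ mzz).1.2 a3
  have hfst := fst_eq_of_triangle hφ hφ' hχ b1 b2 b3
  have hlab : ∀ v, ℓ.label y v = some fiberGen ↔ v = e fiberGen := by
    intro v
    constructor
    · intro hv
      have hadj : (liftGraph φ τ).Adj y v := (ℓ.adj_iff y v).2 (Or.inl (by simp [hv]))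
      obtain ⟨u, hu, rfl⟩ := hsurj v (mem_ballSet_of_adj (self_mem_ballSet _ y 1) hadj)
      rw [← he1, (he _ m1 _ hu).2] at hv
      rw [eq_mul_of_cayleyLabel_eq hv, one_mul]
    · rintro rfl
      rw [← he1, (he _ m1 _ mz).2]
      simpa using cayleyLabel_mul_fiberGen 1
  have hne : (e fiberGen).2 - y.2 ≠ 0 := by
    intro h0
    rw [he1] at b1 hfst
    exact b1.ne (Prod.ext hfst (sub_eq_zero.1 h0).symm)
  refine ⟨Units.mk0 _ hne, fun v => (hlab v).trans ?_⟩
  have : e fiberGen = (y.1, y.2 + (Units.mk0 _ hne : (ZMod 3)ˣ)) :=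
    Prod.ext (by rw [← hfst, he1]) (by simp)
  rw [← this]

/-- The directions of the fibres over adjacent vertices are related by the sign of the edge. -/
lemma fiber_direction_liftPerm
    (hφ : ∀ i j, φ (FreeGroup.of i) = φ (FreeGroup.of j) → i = j)
    (hφ' : ∀ i j, φ (FreeGroup.of i) * φ (FreeGroup.of j) ≠ 1)
    (hφ₁ : ∀ i, φ (FreeGroup.of i) ≠ 1)
    (ℓ : DiagramStruct (liftGraph φ τ) stdGens) {y : P × ZMod 3} (s : Fin 2)
    (hy : LabelledBallIso (liftGraph φ τ) ℓ.label y (cayley stdGens) (cayleyLabel stdGens) 1 2)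
    {j j' : (ZMod 3)ˣ} (hj : ∀ v, ℓ.label y v = some fiberGen ↔ v = (y.1, y.2 + j))
    (hj' : ∀ v, ℓ.label (liftPerm φ τ s y) v = some fiberGen ↔
      v = ((liftPerm φ τ s y).1, (liftPerm φ τ s y).2 + j')) :
    j' = τ y.1 s * j := by
  obtain ⟨e, he1, he, hsurj⟩ := hy.exists_param
  have m1 := self_mem_ballSet (cayley stdGens) 1 2
  have a1 : (cayley stdGens).Adj 1 fiberGen := by simpa using adj_mul_fiberGen 1
  have mz : fiberGen ∈ ballSet (cayley stdGens) 1 2 :=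
    mem_ballSet_of_adj (self_mem_ballSet _ 1 1) a1
  have hadj := liftGraph_adj_liftPerm τ hφ₁ y s
  obtain ⟨t, mt, het⟩ := hsurj _ (mem_ballSet_of_adj (self_mem_ballSet _ y 1) hadj)
  have at1 : (cayley stdGens).Adj 1 t := by
    rw [← (he _ m1 _ mt).1, he1, het]
    exact hadj
  have mtz : t * fiberGen ∈ ballSet (cayley stdGens) 1 2 :=
    mem_ballSet_of_adj (mem_ballSet_of_adj (self_mem_ballSet _ 1 0) at1) (adj_mul_fiberGen t)
  have hv : e fiberGen = (y.1, y.2 + j) := by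
    rw [← hj, ← he1, (he _ m1 _ mz).2]
    simpa using cayleyLabel_mul_fiberGen 1
  have hv' : e (t * fiberGen) = ((liftPerm φ τ s y).1, (liftPerm φ τ s y).2 + j') := by
    rw [← hj', ← het, (he _ mt _ mtz).2]
    exact cayleyLabel_mul_fiberGen t
  have hvv' : (liftGraph φ τ).Adj (e fiberGen) (e (t * fiberGen)) := by
    rw [(he _ mz _ mtz).1, cayley_adj_iff, mul_fiberGen_comm]
    simpa [cayley_adj_iff] using at1
  have h := eq_of_adj_of_fst_eq hφ hφ' hvv' (liftGraph_adj_liftPerm τ hφ₁ _ s)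
    (by rw [hv', hv]; rfl) (by
      rw [hv', hv]
      exact fun h => hφ₁ s (left_eq_mul.1 h))
  rw [hv', hv] at h
  have h2 := (Prod.ext_iff.1 h).2
  simp only [liftPerm_apply, mul_add] at h2
  exact Units.ext (by simpa using h2)

/-- If the signs are far from a coboundary, a definite proportion of vertices of the lift has the
wrong labelled ball. -/
lemma proportion_le_of_far_from_coboundary [Fintype P]
    (hφ : ∀ i j, φ (FreeGroup.of i) = φ (FreeGroup.of j) → i = j)
    (hφ' : ∀ i j, φ (FreeGroup.of i) * φ (FreeGroup.of j) ≠ 1)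
    {χ : P →* ℤˣ} (hχ : ∀ i, χ (φ (FreeGroup.of i)) = -1)
    (hτ : ∀ g : P → (ZMod 3)ˣ, Fintype.card P <
      10 * (Finset.univ.filter fun e : P × Fin 2 =>
        g (e.1 * φ (FreeGroup.of e.2)) ≠ τ e.1 e.2 * g e.1).card)
    (ℓ : DiagramStruct (liftGraph φ τ) stdGens) :
    (Nat.card {x : P × ZMod 3 // LabelledBallIso (liftGraph φ τ) ℓ.label x
      (cayley stdGens) (cayleyLabel stdGens) 1 2} : ℝ) / (Fintype.card (P × ZMod 3) : ℝ)
      ≤ 119 / 120 := by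
  let good : P × ZMod 3 → Prop := fun x => LabelledBallIso (liftGraph φ τ) ℓ.label x
      (cayley stdGens) (cayleyLabel stdGens) 1 2
  have hφ₁ : ∀ i, φ (FreeGroup.of i) ≠ 1 := by
    intro i h
    have := hχ i
    rw [h, map_one] at this
    exact absurd this (by decide)
  have hdir : ∀ x : P, ∃ j : (ZMod 3)ˣ, good (x, 0) →
      ∀ v, ℓ.label (x, 0) v = some fiberGen ↔ v = (x, 0 + (j : ZMod 3)) := by
    intro x
    by_cases hx : good (x, 0)
    · obtain ⟨j, hj⟩ := exists_fiber_direction hφ hφ' hχ ℓ hx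
      exact ⟨j, fun _ => hj⟩
    · exact ⟨1, fun h => absurd h hx⟩
  choose g hg using hdir
  let bad₀ : Finset P := Finset.univ.filter fun x => ¬ good (x, 0)
  let bad : Finset (P × ZMod 3) := Finset.univ.filter fun x => ¬ good x
  have hsub : (Finset.univ.filter fun e : P × Fin 2 =>
      g (e.1 * φ (FreeGroup.of e.2)) ≠ τ e.1 e.2 * g e.1) ⊆
      (bad₀ ×ˢ Finset.univ) ∪ (bad₀ ×ˢ (Finset.univ : Finset (Fin 2))).image
        (fun e => (e.1 * (φ (FreeGroup.of e.2))⁻¹, e.2)) := by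
    rintro ⟨x, s⟩ hxs
    simp only [Finset.mem_filter, Finset.mem_univ, true_and] at hxs
    rw [Finset.mem_union]
    by_contra! hcon
    obtain ⟨h1, h2⟩ := hcon
    have g1 : good (x, 0) := by simpa [bad₀] using h1
    have g2 : good (x * φ (FreeGroup.of s), 0) := by
      by_contra h3
      refine h2 (Finset.mem_image.2 ⟨(x * φ (FreeGroup.of s), s), ?_, ?_⟩)
      · simpa [bad₀] using h3
      · simp
    have hlp : liftPerm φ τ s (x, 0) = (x * φ (FreeGroup.of s), 0) := by simp [liftPerm_apply]
    refine hxs (fiber_direction_liftPerm hφ hφ' hφ₁ ℓ (y := (x, 0)) s g1 (hg x g1) ?_)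
    rw [hlp]
    exact hg _ g2
  have h1 := hτ g
  have h2 := Finset.card_le_card hsub
  have h3 := Finset.card_union_le (bad₀ ×ˢ Finset.univ)
    ((bad₀ ×ˢ (Finset.univ : Finset (Fin 2))).image
        (fun e => (e.1 * (φ (FreeGroup.of e.2))⁻¹, e.2)))
  have h4 := Finset.card_image_le (s := bad₀ ×ˢ (Finset.univ : Finset (Fin 2)))
        (f := fun e => (e.1 * (φ (FreeGroup.of e.2))⁻¹, e.2))
  have h5 : (bad₀ ×ˢ (Finset.univ : Finset (Fin 2))).card = bad₀.card * 2 := by simp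
  have h6 : bad₀.card ≤ bad.card :=
    Finset.card_le_card_of_injOn (fun x => (x, 0)) (fun x hx => by simpa [bad₀, bad] using hx)
      (fun x _ x' _ h => congrArg Prod.fst h)
  have h7 : (Finset.univ.filter good).card + bad.card = Fintype.card (P × ZMod 3) :=
    Finset.card_filter_add_card_filter_not _
  have h8 : Fintype.card (P × ZMod 3) = 3 * Fintype.card P := by
    rw [Fintype.card_prod, ZMod.card, mul_comm]
  have h9 : Nat.card {x // good x} = (Finset.univ.filter good).card := by
    rw [Nat.card_eq_fintype_card, Fintype.card_subtype]
  have hpos : 0 < Fintype.card P := Fintype.card_pos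
  have h10 : 120 * Nat.card {x // good x} ≤ 119 * Fintype.card (P × ZMod 3) := by omega
  have hpos' : (0 : ℝ) < Fintype.card (P × ZMod 3) := by
    rw [h8]; exact_mod_cast by omega
  rw [div_le_iff₀ hpos']
  have h11 : (120 : ℝ) * Nat.card {x // good x} ≤ 119 * Fintype.card (P × ZMod 3) := by
    exact_mod_cast h10
  change (Nat.card {x // good x} : ℝ) ≤ _
  linarith

end Rigidity

lemma exists_locally_cayley_not_labellable (n : ℕ) :
    ∃ (V : Type) (_ : Fintype V) (G : SimpleGraph V), 0 < Fintype.card V ∧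
      (∀ r ≤ n, ∀ y, RootedBallIso G y (cayley stdGens) 1 r) ∧
      ∀ ℓ : DiagramStruct G stdGens,
        (Nat.card {x : V // LabelledBallIso G ℓ.label x
          (cayley stdGens) (cayleyLabel stdGens) 1 2} : ℝ) / (Fintype.card V : ℝ)
          ≤ 119 / 120 := by
  let B : Set (FreeGroup (Fin 2)) :=
    Prod.fst '' ballSet (cayley stdGens) 1 (n + 1) ∪
      ({1} ∪ (Set.range FreeGroup.of ∪
        Set.range fun p : Fin 2 × Fin 2 => FreeGroup.of p.1 * FreeGroup.of p.2))
  have hB : B.Finite :=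
    ((finite_ballSet _ finite_cayley_neighbors _ _).image _).union
      ((Set.finite_singleton _).union ((Set.finite_range _).union (Set.finite_range _)))
  obtain ⟨P, _, _, φ₀, hφ₀⟩ := exists_finite_quotient_injOn B hB
  let φ : FreeGroup (Fin 2) →* P × ℤˣ := φ₀.prod (FreeGroup.lift fun _ => -1)
  have hφB : Set.InjOn φ B := fun u hu v hv h => hφ₀ hu hv (congrArg Prod.fst h)
  have hφ : ∀ i j, φ (FreeGroup.of i) = φ (FreeGroup.of j) → i = j := fun i j h =>
    FreeGroup.of_injective
      (hφB (Or.inr (Or.inr (Or.inl ⟨i, rfl⟩))) (Or.inr (Or.inr (Or.inl ⟨j, rfl⟩))) h)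
  have hne : ∀ i j : Fin 2, FreeGroup.of i * FreeGroup.of j ≠ 1 := by
    intro i j h
    have := congrArg (FreeGroup.lift fun _ => (Multiplicative.ofAdd (1 : ℤ))) h
    simp only [_root_.map_mul, FreeGroup.lift_apply_of, _root_.map_one] at this
    exact absurd this (by decide)
  have hφ' : ∀ i j, φ (FreeGroup.of i) * φ (FreeGroup.of j) ≠ 1 := by
    intro i j h
    rw [← _root_.map_mul, ← _root_.map_one φ] at h
    exact hne i j (hφB (Or.inr (Or.inr (Or.inr ⟨(i, j), rfl⟩))) (Or.inr (Or.inl rfl)) h)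
  have hχ : ∀ i, MonoidHom.snd P ℤˣ (φ (FreeGroup.of i)) = -1 := by
    intro i; simp [φ]
  have hφ₁ : ∀ i, φ (FreeGroup.of i) ≠ 1 := fun i h => by
    rw [← _root_.map_one φ] at h
    exact FreeGroup.of_ne_one i
      (hφB (Or.inr (Or.inr (Or.inl ⟨i, rfl⟩))) (Or.inr (Or.inl rfl)) h)
  obtain ⟨τ, hτ⟩ := exists_signs_far_from_coboundary (P := P × ℤˣ) (U := (ZMod 3)ˣ)
    (by decide) (fun x s => x * φ (FreeGroup.of s))
  refine ⟨(P × ℤˣ) × ZMod 3, inferInstance, liftGraph φ τ, Fintype.card_pos, ?_,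
    proportion_le_of_far_from_coboundary hφ hφ' hχ fun g => by convert hτ g⟩
  intro r hr y
  refine rootedBallIso_liftGraph τ hφ₁ r (hφB.mono ?_) y
  exact (Set.image_mono (ballSet_mono _ _ (by omega))).trans Set.subset_union_left

/-- There exist a finitely generated group `Γ` with a finite
generating set `S` (with `1 ∉ S`) and a sequence `G n` of finite graphs
Benjamini–Schramm converging to the Cayley graph `Cay(Γ, S)`, such that there is
no sequence of `S`-diagram structures `ℓ n` on the graphs `G n` making the
diagrams `(G n, ℓ n)` converge to the Cayley diagram of `(Γ, S)`: for every
choice of diagram structures it fails that, for every `r`, the proportion of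
vertices whose labelled rooted `r`-ball is rooted labelled-isomorphic to the
labelled rooted `r`-ball of the Cayley diagram at the identity tends to `1`. -/
theorem stmt_0 : ∃ (Γ : Type) (_ : Group Γ) (S : Set Γ)
    (V : ℕ → Type) (_ : ∀ n, Fintype (V n)) (G : ∀ n, SimpleGraph (V n)),
    S.Finite ∧ (1 : Γ) ∉ S ∧ Subgroup.closure S = ⊤ ∧
    BSLimit G (cayley S) 1 ∧
    ∀ ℓ : ∀ n, DiagramStruct (G n) S,
      ¬ (∀ r : ℕ, Tendsto (fun n =>
            (Nat.card {x : V n // LabelledBallIso (G n) (ℓ n).label x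
                (cayley S) (cayleyLabel S) 1 r} : ℝ) / (Fintype.card (V n) : ℝ))
          atTop (𝓝 1)) := by
  choose V hV G hpos hiso hlab using exists_locally_cayley_not_labellable
  refine ⟨FreeProdThree, inferInstance, stdGens, V, hV, G, finite_stdGens, one_notMem_stdGens,
    closure_stdGens, fun r => ?_, fun ℓ h => ?_⟩
  · refine tendsto_const_nhds.congr' ?_
    filter_upwards [eventually_ge_atTop r] with n hn
    have hcard : Nat.card {x : V n // RootedBallIso (G n) x (cayley stdGens) 1 r} =
        Fintype.card (V n) := by
      rw [← Nat.card_eq_fintype_card]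
      exact Nat.card_congr (Equiv.subtypeUnivEquiv (hiso n r hn))
    rw [ballIsoProportion, hcard, div_self (by exact_mod_cast (hpos n).ne')]
  · have := le_of_tendsto' (h 2) fun n => hlab n (ℓ n)
    norm_num at this
end

section
/- The Cayley graph Cay(Γ, S), where Γ = ⟨a,b,c,d | b², c², d², cdcd, ada⁻¹c, aca⁻¹d, bcbd⟩ and S = {a, a⁻¹, b, c, d}, is isomorphic as a simple graph to the box product T₃ □ C₄. -/
open Filter Topology SimpleGraph
open scoped Classical

/-- The free product `F = ℤ * (ℤ/2ℤ)`. -/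
abbrev F : Type := Monoid.Coprod (Multiplicative ℤ) (Multiplicative (ZMod 2))

/-- The image in `F` of a generator of `ℤ`. -/
def aF : F := Monoid.Coprod.inl (Multiplicative.ofAdd (1 : ℤ))

/-- The image in `F` of the generator of `ℤ/2ℤ`. -/
def bF : F := Monoid.Coprod.inr (Multiplicative.ofAdd (1 : ZMod 2))

/-- The generating set `{a, a⁻¹, b}` of `F`. -/
def SF : Set F := {aF, aF⁻¹, bF}

/-- The 3-regular tree `T₃ = Cay(F, {a, a⁻¹, b})`. -/
def T3 : SimpleGraph F := cayley SF

/-- The cycle graph on 4 vertices. -/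
def C4 : SimpleGraph (ZMod 4) := SimpleGraph.fromRel (fun x y => y = x + 1)

/-- The free-group letters `a, b, c, d`. -/
private def fa : FreeGroup (Fin 4) := FreeGroup.of 0
private def fb : FreeGroup (Fin 4) := FreeGroup.of 1
private def fc : FreeGroup (Fin 4) := FreeGroup.of 2
private def fd : FreeGroup (Fin 4) := FreeGroup.of 3

/-- The relators `b², c², d², cdcd, ada⁻¹c, aca⁻¹d, bcbd`. -/
def rels : Set (FreeGroup (Fin 4)) :=
  {fb ^ 2, fc ^ 2, fd ^ 2, fc * fd * fc * fd, fa * fd * fa⁻¹ * fc,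
    fa * fc * fa⁻¹ * fd, fb * fc * fb * fd}

/-- The group `Γ = ⟨a,b,c,d | b², c², d², cdcd, ada⁻¹c, aca⁻¹d, bcbd⟩`. -/
abbrev Γp : Type := PresentedGroup rels

/-- The images of the generating symbols `a, b, c, d` in `Γ`. -/
def ga : Γp := PresentedGroup.of 0
def gb : Γp := PresentedGroup.of 1
def gc : Γp := PresentedGroup.of 2
def gd : Γp := PresentedGroup.of 3

/-- The generating set `S = {a, a⁻¹, b, c, d}` of `Γ`. -/
def SΓ : Set Γp := {ga, ga⁻¹, gb, gc, gd}

/-- The homomorphism from the group of order two determined by an element of square one. -/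
def homOfSqEqOne {G : Type*} [Group G] (g : G) (hg : g ^ 2 = 1) :
    Multiplicative (ZMod 2) →* G where
  toFun x := g ^ (ZMod.val x.toAdd)
  map_one' := by simp
  map_mul' x y := by
    rw [← pow_add, toAdd_mul, ZMod.val_add, ← pow_mod_orderOf,
      Nat.mod_mod_of_dvd _ (orderOf_dvd_of_pow_eq_one hg), pow_mod_orderOf]

@[simp]
lemma homOfSqEqOne_ofAdd_one {G : Type*} [Group G] (g : G) (hg : g ^ 2 = 1) :
    homOfSqEqOne g hg (Multiplicative.ofAdd 1) = g := by
  change g ^ (ZMod.val (1 : ZMod 2)) = g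
  simp [ZMod.val_one]

lemma hom_ext_of_ofAdd_one {G : Type*} [Group G] {f g : Multiplicative (ZMod 2) →* G}
    (h : f (Multiplicative.ofAdd 1) = g (Multiplicative.ofAdd 1)) : f = g := by
  apply MonoidHom.ext
  intro x
  have hx : x = 1 ∨ x = Multiplicative.ofAdd 1 := by revert x; decide
  rcases hx with rfl | rfl
  · simp
  · exact h

/-- The Klein four-group. -/
abbrev V4 : Type := Multiplicative (ZMod 2) × Multiplicative (ZMod 2)

/-- The first generator of the Klein four-group. -/
def cV : V4 := (Multiplicative.ofAdd 1, 1)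

/-- The second generator of the Klein four-group. -/
def dV : V4 := (1, Multiplicative.ofAdd 1)

@[simp]
lemma swap_cV : cV.swap = dV := rfl

@[simp]
lemma swap_dV : dV.swap = cV := rfl

lemma swap_sq : (MulEquiv.prodComm : MulAut V4) ^ 2 = 1 := by
  ext x <;> rfl

/-- The action of `F` on the Klein four-group in which both generators exchange
the two factors. -/
def swapAction : F →* MulAut V4 :=
  Monoid.Coprod.lift (zpowersHom _ MulEquiv.prodComm) (homOfSqEqOne _ swap_sq)

@[simp]
lemma swapAction_aF : swapAction aF = MulEquiv.prodComm := by
  simp [swapAction, aF]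

@[simp]
lemma swapAction_bF : swapAction bF = MulEquiv.prodComm := by
  simp [swapAction, bF]

lemma bF_sq : bF ^ 2 = 1 := by
  rw [bF, ← map_pow]
  exact map_one _

lemma F_hom_ext {G : Type*} [Group G] {f g : F →* G} (ha : f aF = g aF) (hb : f bF = g bF) :
    f = g := by
  apply Monoid.Coprod.hom_ext
  · exact MonoidHom.ext_mint ha
  · exact hom_ext_of_ofAdd_one hb

lemma F_induction {p : F → Prop} (one : p 1) (mul : ∀ x y, p x → p y → p (x * y))
    (inv : ∀ x, p x → p x⁻¹) (ha : p aF) (hb : p bF) (x : F) : p x := by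
  let H : Subgroup F :=
    { carrier := {x | p x}, one_mem' := one, mul_mem' := fun {x y} => mul x y,
      inv_mem' := fun {x} => inv x }
  have key : (H.subtype.comp (Monoid.Coprod.lift (zpowersHom H ⟨aF, ha⟩)
      (homOfSqEqOne (⟨bF, hb⟩ : H) (Subtype.ext bF_sq)))) = MonoidHom.id F := by
    apply F_hom_ext
    · simp [aF]
    · simp [bF]
  rw [← MonoidHom.id_apply F x, ← key]
  exact Subtype.property _

/-- The set of the two standard generators of the Klein four-group. -/
def SV : Set V4 := {cV, dV}

lemma swapAction_mem_SV (w : F) : ∀ v, swapAction w v ∈ SV ↔ v ∈ SV := by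
  have hswap : ∀ v : V4, (MulEquiv.prodComm : MulAut V4) v ∈ SV ↔ v ∈ SV := by
    simp only [SV, Set.mem_insert_iff, Set.mem_singleton_iff]
    decide
  induction w using F_induction with
  | one => simp
  | mul x y hx hy => intro v; rw [map_mul, MulAut.mul_apply, hx, hy]
  | inv x hx => intro v; rw [← hx, ← MulAut.mul_apply, ← map_mul]; simp
  | ha => simpa using hswap
  | hb => simpa using hswap

lemma gb_sq : gb ^ 2 = 1 :=
  PresentedGroup.one_of_mem (rels := rels) (x := fb ^ 2) (by simp [rels])

lemma gc_sq : gc ^ 2 = 1 :=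
  PresentedGroup.one_of_mem (rels := rels) (x := fc ^ 2) (by simp [rels])

lemma gd_sq : gd ^ 2 = 1 :=
  PresentedGroup.one_of_mem (rels := rels) (x := fd ^ 2) (by simp [rels])

lemma gc_inv : gc⁻¹ = gc := inv_eq_of_mul_eq_one_right (by rw [← sq, gc_sq])

lemma gd_inv : gd⁻¹ = gd := inv_eq_of_mul_eq_one_right (by rw [← sq, gd_sq])

lemma gc_commute_gd : Commute gc gd := by
  have h : gc * gd * gc * gd = 1 :=
    PresentedGroup.one_of_mem (rels := rels) (x := fc * fd * fc * fd) (by simp [rels])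
  have := eq_inv_of_mul_eq_one_left (show gc * gd * (gc * gd) = 1 by simpa [mul_assoc] using h)
  rwa [mul_inv_rev, gc_inv, gd_inv] at this

lemma ga_conj_gd : ga * gd * ga⁻¹ = gc := by
  have h : ga * gd * ga⁻¹ * gc = 1 :=
    PresentedGroup.one_of_mem (rels := rels) (x := fa * fd * fa⁻¹ * fc) (by simp [rels])
  rw [eq_inv_of_mul_eq_one_left h, gc_inv]

lemma ga_conj_gc : ga * gc * ga⁻¹ = gd := by
  have h : ga * gc * ga⁻¹ * gd = 1 :=
    PresentedGroup.one_of_mem (rels := rels) (x := fa * fc * fa⁻¹ * fd) (by simp [rels])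
  rw [eq_inv_of_mul_eq_one_left h, gd_inv]

lemma gb_inv : gb⁻¹ = gb := inv_eq_of_mul_eq_one_right (by rw [← sq, gb_sq])

lemma gb_conj_gc : gb * gc * gb⁻¹ = gd := by
  have h : gb * gc * gb * gd = 1 :=
    PresentedGroup.one_of_mem (rels := rels) (x := fb * fc * fb * fd) (by simp [rels])
  rw [gb_inv, eq_inv_of_mul_eq_one_left h, gd_inv]

lemma gb_conj_gd : gb * gd * gb⁻¹ = gc := by
  rw [← gb_conj_gc, gb_inv]
  have h : gb * gb = 1 := by rw [← sq, gb_sq]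
  rw [mul_assoc, mul_assoc, mul_assoc, h, mul_one, ← mul_assoc, h, one_mul]

/-- The homomorphism from the Klein four-group onto the subgroup `⟨c, d⟩` of `Γ`. -/
def homV4 : V4 →* Γp :=
  (homOfSqEqOne gc gc_sq).noncommCoprod (homOfSqEqOne gd gd_sq)
    fun _ _ => (gc_commute_gd.pow_pow _ _)

@[simp]
lemma homV4_cV : homV4 cV = gc := (MonoidHom.noncommCoprod_apply ..).trans (by simp [cV])

@[simp]
lemma homV4_dV : homV4 dV = gd := (MonoidHom.noncommCoprod_apply ..).trans (by simp [dV])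

lemma V4_hom_ext {G : Type*} [Group G] {f g : V4 →* G} (hc : f cV = g cV) (hd : f dV = g dV) :
    f = g := by
  apply MonoidHom.ext
  intro x
  have hx : x = 1 ∨ x = cV ∨ x = dV ∨ x = cV * dV := by revert x; decide
  rcases hx with rfl | rfl | rfl | rfl <;> simp [hc, hd]

/-- The homomorphism from `F` onto the subgroup `⟨a, b⟩` of `Γ`. -/
def homF : F →* Γp := Monoid.Coprod.lift (zpowersHom _ ga) (homOfSqEqOne gb gb_sq)

@[simp]
lemma homF_aF : homF aF = ga := by simp [homF, aF]

@[simp]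
lemma homF_bF : homF bF = gb := by simp [homF, bF]

lemma homV4_swapAction (w : F) :
    homV4.comp (swapAction w).toMonoidHom =
      (MulAut.conj (homF w)).toMonoidHom.comp homV4 := by
  induction w using F_induction with
  | one => ext; simp
  | mul x y hx hy =>
    apply MonoidHom.ext
    intro v
    have h1 := DFunLike.congr_fun hx (swapAction y v)
    have h2 := DFunLike.congr_fun hy v
    simp at h1 h2 ⊢
    simp only [h1, h2, mul_assoc]
  | inv x hx =>
    apply MonoidHom.ext
    intro v
    have h1 := DFunLike.congr_fun hx ((swapAction x)⁻¹ v)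
    simp at h1 ⊢
    rw [h1]
    group
  | ha => apply V4_hom_ext <;> simp [ga_conj_gc, ga_conj_gd]
  | hb => apply V4_hom_ext <;> simp [gb_conj_gc, gb_conj_gd]

/-- The semidirect product of the Klein four-group by `F`. -/
abbrev V4F : Type := V4 ⋊[swapAction] F

/-- The homomorphism from the semidirect product to `Γ`. -/
def ofV4F : V4F →* Γp := SemidirectProduct.lift homV4 homF homV4_swapAction

/-- The images of `a, b, c, d` in the semidirect product. -/
def genV4F : Fin 4 → V4F :=
  ![SemidirectProduct.inr aF, SemidirectProduct.inr bF,
    SemidirectProduct.inl cV, SemidirectProduct.inl dV]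

lemma genV4F_rels : ∀ r ∈ rels, FreeGroup.lift genV4F r = 1 := by
  have hbb : bF * bF = 1 := by rw [← sq, bF_sq]
  have hcc : cV * cV = 1 := rfl
  have hdd : dV * dV = 1 := rfl
  have hcd : cV * dV * cV * dV = 1 := rfl
  rintro r (rfl | rfl | rfl | rfl | rfl | rfl | rfl) <;>
    ext1 <;>
    simp [fa, fb, fc, fd, genV4F, sq, hbb, hcc, hdd, hcd]

/-- The homomorphism from `Γ` to the semidirect product. -/
def toV4F : Γp →* V4F := PresentedGroup.toGroup genV4F_rels

@[simp]
lemma toV4F_ga : toV4F ga = SemidirectProduct.inr aF := PresentedGroup.toGroup.of genV4F_rels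

@[simp]
lemma toV4F_gb : toV4F gb = SemidirectProduct.inr bF := PresentedGroup.toGroup.of genV4F_rels

@[simp]
lemma toV4F_gc : toV4F gc = SemidirectProduct.inl cV := PresentedGroup.toGroup.of genV4F_rels

@[simp]
lemma toV4F_gd : toV4F gd = SemidirectProduct.inl dV := PresentedGroup.toGroup.of genV4F_rels

/-- `Γ` is the semidirect product of the Klein four-group by `F`. -/
def equivV4F : Γp ≃* V4F :=
  MonoidHom.toMulEquiv toV4F ofV4F
    (by
      apply PresentedGroup.ext
      intro i
      fin_cases i
      · change ofV4F (toV4F ga) = ga; simp [ofV4F]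
      · change ofV4F (toV4F gb) = gb; simp [ofV4F]
      · change ofV4F (toV4F gc) = gc; simp [ofV4F]
      · change ofV4F (toV4F gd) = gd; simp [ofV4F])
    (by
      apply SemidirectProduct.hom_ext
      · apply V4_hom_ext <;> simp [ofV4F]
      · apply F_hom_ext <;> simp [ofV4F])

lemma mem_SΓ_iff (x : Γp) :
    x ∈ SΓ ↔ ((equivV4F x).left = 1 ∧ (equivV4F x).right ∈ SF) ∨
      ((equivV4F x).right = 1 ∧ (equivV4F x).left ∈ SV) := by
  have h : x ∈ SΓ ↔ equivV4F x ∈ ({SemidirectProduct.inr aF, SemidirectProduct.inr aF⁻¹,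
      SemidirectProduct.inr bF, SemidirectProduct.inl cV, SemidirectProduct.inl dV} : Set V4F) := by
    have ha : equivV4F ga = _ := toV4F_ga
    have hb : equivV4F gb = _ := toV4F_gb
    have hc : equivV4F gc = _ := toV4F_gc
    have hd : equivV4F gd = _ := toV4F_gd
    simp only [SΓ, Set.mem_insert_iff, Set.mem_singleton_iff, map_inv, ← ha, ← hb, ← hc, ← hd]
    simp only [← map_inv, EmbeddingLike.apply_eq_iff_eq]
  rw [h]
  simp only [SF, SV, Set.mem_insert_iff, Set.mem_singleton_iff, SemidirectProduct.ext_iff,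
    SemidirectProduct.left_inr, SemidirectProduct.right_inr,
    SemidirectProduct.left_inl, SemidirectProduct.right_inl]
  tauto

/-- Going around the square with vertices `1, c, cd, d`. -/
def equivZMod4 : V4 ≃ ZMod 4 where
  toFun v := if v = 1 then 0 else if v = cV then 1 else if v = dV then 3 else 2
  invFun i := if i = 0 then 1 else if i = 1 then cV else if i = 2 then cV * dV else dV
  left_inv := by unfold Function.LeftInverse; decide
  right_inv := by unfold Function.RightInverse Function.LeftInverse; decide

lemma cayley_SV_adj_iff : ∀ v v' : V4,
    (cayley SV).Adj v v' ↔ C4.Adj (equivZMod4 v) (equivZMod4 v') := by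
  simp only [cayley, C4, SimpleGraph.fromRel_adj, SV, Set.mem_insert_iff, Set.mem_singleton_iff]
  decide

lemma cayley_SΓ_adj_iff (x y : Γp) :
    (cayley SΓ).Adj x y ↔
      (T3 □ cayley SV).Adj ((equivV4F x).right, (equivV4F x).left)
        ((equivV4F y).right, (equivV4F y).left) := by
  have hne : x ≠ y ↔ ¬ ((equivV4F x).left = (equivV4F y).left ∧
      (equivV4F x).right = (equivV4F y).right) := by
    rw [← SemidirectProduct.ext_iff, EmbeddingLike.apply_eq_iff_eq]
  have hmem : ∀ x y : Γp, x⁻¹ * y ∈ SΓ ↔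
      ((equivV4F x).left = (equivV4F y).left ∧
        (equivV4F x).right⁻¹ * (equivV4F y).right ∈ SF) ∨
      ((equivV4F x).right = (equivV4F y).right ∧
        (equivV4F x).left⁻¹ * (equivV4F y).left ∈ SV) := by
    intro x y
    have hleft : (equivV4F (x⁻¹ * y)).left =
        swapAction (equivV4F x).right⁻¹ ((equivV4F x).left⁻¹ * (equivV4F y).left) := by
      simp
    rw [mem_SΓ_iff, hleft, swapAction_mem_SV, EmbeddingLike.map_eq_one_iff, inv_mul_eq_one]
    simp only [map_mul, map_inv, SemidirectProduct.mul_right, SemidirectProduct.inv_right,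
      inv_mul_eq_one]
  simp only [T3, cayley, SimpleGraph.boxProd_adj, SimpleGraph.fromRel_adj, hmem, hne]
  grind

/-- The Cayley graph `Cay(Γ, S)`, where
`Γ = ⟨a,b,c,d | b², c², d², cdcd, ada⁻¹c, aca⁻¹d, bcbd⟩` and
`S = {a, a⁻¹, b, c, d}`, is isomorphic as a simple graph to the box product
`T₃ □ C₄`. -/
theorem stmt_3 : Nonempty ((cayley SΓ) ≃g (T3 □ C4)) := by
  refine ⟨⟨(equivV4F.toEquiv.trans SemidirectProduct.equivProd).trans
    ((Equiv.prodComm _ _).trans (Equiv.prodCongr (Equiv.refl _) equivZMod4)), ?_⟩⟩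
  intro x y
  rw [cayley_SΓ_adj_iff]
  simp [SimpleGraph.boxProd_adj, cayley_SV_adj_iff]
end

section
/- Let B be a finite graph that contains a Hamiltonian cycle and whose number of vertices is congruent to 2 modulo 4. Then the box product B □ C₄ contains a Hamiltonian cycle in which the edges alternate between edges of the C₄-factor and edges of the B-factor: along the cycle, every second edge is of the form {(x,u),(x,v)} with u,v adjacent in C₄, and the remaining edges are of the form {(x,u),(y,u)} with x,y adjacent in B. -/
open SimpleGraph

namespace SimpleGraph.Walk

variable {α : Type*} {G : SimpleGraph α}

theorem exists_getVert_eq_of_adj_succ (f : ℕ → α) (hf : ∀ i, G.Adj (f i) (f (i + 1))) (m : ℕ) :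
    ∃ p : G.Walk (f 0) (f m), p.length = m ∧ ∀ i ≤ m, p.getVert i = f i := by
  induction m generalizing f with
  | zero => exact ⟨.nil, by simp⟩
  | succ m ih =>
    obtain ⟨p, hp, hpf⟩ := ih (fun i => f (i + 1)) fun i => hf (i + 1)
    refine ⟨.cons (hf 0) p, by simp [hp], ?_⟩
    rintro (_ | i) hi
    · simp
    · simpa using hpf i (by lia)

theorem exists_isHamiltonianCycle_of_injOn [Fintype α] [DecidableEq α] (f : ℕ → α)
    (hf : ∀ i, G.Adj (f i) (f (i + 1))) (h3 : 3 ≤ Fintype.card α)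
    (hclose : f (Fintype.card α) = f 0) (hinj : Set.InjOn f (Set.Iio (Fintype.card α))) :
    ∃ p : G.Walk (f 0) (f 0), p.IsHamiltonianCycle ∧
      ∀ i ≤ Fintype.card α, p.getVert i = f i := by
  obtain ⟨p, hp, hpf⟩ : ∃ p : G.Walk (f 0) (f 0), p.length = Fintype.card α ∧
      ∀ i ≤ Fintype.card α, p.getVert i = f i := by
    obtain ⟨q, hq, hqf⟩ := exists_getVert_eq_of_adj_succ f hf (Fintype.card α)
    exact ⟨q.copy rfl hclose, by simpa using hq, by simpa using hqf⟩
  have hnil : ¬ p.Nil := by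
    rw [not_nil_iff_lt_length]
    lia
  refine ⟨p, isHamiltonianCycle_iff_isCycle_and_length_eq.2
    ⟨isCycle_iff_isPath_tail_and_le_length.2
      ⟨(IsPath.getVert_injOn_iff _).1 fun i hi j hj h => ?_, by lia⟩, hp⟩, hpf⟩
  have htail := length_tail_add_one hnil
  rw [Set.mem_ofPred] at hi hj
  rw [getVert_tail, getVert_tail, hpf _ (by lia), hpf _ (by lia)] at h
  have hwrap (k : ℕ) (hk : k < Fintype.card α) :
      f (k + 1) = f ((k + 1) % Fintype.card α) := by
    obtain hk | hk := (Nat.succ_le_of_lt hk).eq_or_lt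
    · rw [← Nat.succ_eq_add_one, hk, hclose, Nat.mod_self]
    · rw [Nat.mod_eq_of_lt hk]
  rw [hwrap i (by lia), hwrap j (by lia)] at h
  have hpos : 0 < Fintype.card α := by lia
  have hmod : i + 1 ≡ j + 1 [MOD Fintype.card α] :=
    hinj (Nat.mod_lt _ hpos) (Nat.mod_lt _ hpos) h
  exact (Nat.ModEq.add_right_cancel' 1 hmod).eq_of_lt_of_lt (by lia) (by lia)

end SimpleGraph.Walk

theorem C4_adj_add_one (x : ZMod 4) : C4.Adj x (x + 1) := by
  rw [C4, fromRel_adj]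
  exact ⟨by simpa [eq_comm] using (by decide : (1 : ZMod 4) ≠ 0), .inl rfl⟩

theorem exists_enumeration_of_isHamiltonianCycle {V : Type*} [Fintype V] [DecidableEq V]
    {B : SimpleGraph V} {v : V} {c : B.Walk v v} (hc : c.IsHamiltonianCycle) :
    ∃ b : ℕ → V, (∀ i, B.Adj (b i) (b (i + 1))) ∧
      ∀ i j, b i = b j ↔ i ≡ j [MOD Fintype.card V] := by
  have hlen := hc.length_eq
  have h3 := hc.isCycle.three_le_length
  rw [← hlen]
  have hlt (i : ℕ) : i % c.length < c.length := Nat.mod_lt _ (by lia)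
  refine ⟨fun i => c.getVert (i % c.length), fun i => ?_, fun i j => ⟨fun h => ?_, fun h => ?_⟩⟩
  · have h := c.adj_getVert_succ (hlt i)
    convert h using 1
    beta_reduce
    have h' := hlt i
    by_cases hi : i % c.length + 1 = c.length
    · rw [hi, Nat.add_mod, Nat.mod_eq_of_lt (show 1 < c.length by lia), hi]
      simp
    · rw [Nat.add_mod, Nat.mod_eq_of_lt (show 1 < c.length by lia), Nat.mod_eq_of_lt (by lia)]
  · exact hc.isCycle.getVert_injOn' (by simpa using (by have := hlt i; lia))
      (by simpa using (by have := hlt j; lia)) h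
  · exact congrArg c.getVert h

theorem eq_of_div_two_modEq {n i j : ℕ} (hn : n % 4 = 2) (hi : i < n * 4) (hj : j < n * 4)
    (h₁ : i / 2 ≡ j / 2 [MOD n]) (h₂ : (i + 1) / 2 ≡ (j + 1) / 2 [MOD 4]) : i = j := by
  have h₃ : i / 2 ≡ j / 2 [MOD 2] := h₁.of_dvd (by lia)
  have h₄ : i / 2 ≡ j / 2 [MOD 4] := by
    simp only [Nat.ModEq] at *
    lia
  obtain ⟨k, rfl⟩ : ∃ k, n = 2 * k := ⟨n / 2, by lia⟩
  have hcop : Nat.Coprime 4 k := by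
    rw [show 4 = 2 ^ 2 by rfl]
    exact Nat.Coprime.pow_left _ (Nat.coprime_two_left.2 (Nat.odd_iff.2 (by lia)))
  have h₅ : i / 2 ≡ j / 2 [MOD 4 * k] :=
    (Nat.modEq_and_modEq_iff_modEq_mul hcop).1 ⟨h₄, h₁.of_dvd (Dvd.intro_left _ rfl)⟩
  have h₆ : i / 2 = j / 2 := h₅.eq_of_lt_of_lt (by lia) (by lia)
  simp only [Nat.ModEq] at h₂
  lia

/-- Let `B` be a finite graph containing a Hamiltonian cycle,
whose number of vertices is congruent to 2 modulo 4. Then the box product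
`B □ C₄` contains a Hamiltonian cycle in which the edges alternate between edges
of the `C₄`-factor (endpoints agreeing in the `B`-coordinate) and edges of the
`B`-factor (endpoints agreeing in the `C₄`-coordinate). -/
theorem stmt_7 {V : Type} [Fintype V] [DecidableEq V] (B : SimpleGraph V)
    (hham : ∃ (v : V) (c : B.Walk v v), c.IsHamiltonianCycle)
    (hcard : Fintype.card V % 4 = 2) :
    ∃ (v : V × ZMod 4) (c : (B □ C4).Walk v v), c.IsHamiltonianCycle ∧
      ∀ (i : ℕ) (h : i < c.darts.length),
        (Even i → (c.darts.get ⟨i, h⟩).toProd.1.1 = (c.darts.get ⟨i, h⟩).toProd.2.1) ∧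
        (¬ Even i → (c.darts.get ⟨i, h⟩).toProd.1.2 = (c.darts.get ⟨i, h⟩).toProd.2.2) := by
  obtain ⟨v, c, hc⟩ := hham
  have hV : 3 ≤ Fintype.card V := hc.length_eq ▸ hc.isCycle.three_le_length
  have hcard' : Fintype.card (V × ZMod 4) = Fintype.card V * 4 := by simp [ZMod.card]
  obtain ⟨b, hadj, hb⟩ := exists_enumeration_of_isHamiltonianCycle hc
  let f : ℕ → V × ZMod 4 := fun i => (b (i / 2), ((i + 1) / 2 : ℕ))
  have heven (i : ℕ) (hi : Even i) : (i + 1) / 2 = i / 2 := by grind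
  have hodd (i : ℕ) (hi : ¬ Even i) : (i + 1) / 2 = i / 2 + 1 := by grind
  have hf (i : ℕ) : (B □ C4).Adj (f i) (f (i + 1)) := by
    rw [boxProd_adj]
    by_cases hi : Even i
    · have h := hodd (i + 1) (by grind)
      right
      simpa [f, heven i hi, h] using C4_adj_add_one _
    · have h := heven (i + 1) (by grind)
      left
      simpa [f, hodd i hi, h] using hadj _
  obtain ⟨p, hp, hpf⟩ := Walk.exists_isHamiltonianCycle_of_injOn f hf (by lia)
    (by
      rw [hcard']
      refine Prod.ext ((hb _ _).2 ?_) ((ZMod.natCast_eq_natCast_iff _ _ _).2 ?_)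
      · rw [show Fintype.card V * 4 / 2 = 2 * Fintype.card V by lia]
        simp [Nat.ModEq]
      · simp only [Nat.ModEq]
        lia)
    (by
      rw [hcard']
      intro i hi j hj h
      exact eq_of_div_two_modEq hcard hi hj ((hb _ _).1 (congrArg Prod.fst h))
        ((ZMod.natCast_eq_natCast_iff _ _ _).1 (congrArg Prod.snd h)))
  refine ⟨f 0, p, hp, fun i h => ?_⟩
  have hi : i < Fintype.card (V × ZMod 4) := by
    rwa [Walk.length_darts, hp.length_eq] at h
  simp only [List.get_eq_getElem, Walk.fst_darts_getElem, Walk.snd_darts_getElem,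
    Walk.support_getElem_eq_getVert, List.getElem_tail,
    List.getElem_dropLast]
  rw [hpf i hi.le, hpf (i + 1) hi]
  exact ⟨fun he => congrArg b (heven i he).symm, fun ho => by
    simp [f, heven (i + 1) (by grind)]⟩
end
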